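/- arXiv:math/0402249 — 2 statements merged into one kernel-verified Lean document; each statement's English description precedes it below -/
import Mathlib

section
/- Let G = SL(n, ℂ), Ω = SU(n), and L_G the positive definite hermitian determinant-1 matrices with loop operation ∘ given by polar decomposition. For ω ∈ Ω define ω̂ : L_G → L_G by ω̂(A) = ωAω⁻¹. Then the left inner mapping group Δ(L_G) equals { ω̂ : ω ∈ Ω }; in particular each δ_{A,B} equals the conjugation map by d_{A,B}. -/
/-- A loop: a binary operation with two-sided identity whose left and right
translations are bijections. -/
structure LoopStr (L : Type*) where
  mul : L → L → L
  one : L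
  one_mul : ∀ x, mul one x = x
  mul_one : ∀ x, mul x one = x
  mul_left_bij : ∀ x, Function.Bijective (mul x)
  mul_right_bij : ∀ x, Function.Bijective fun y => mul y x

/-- Left translation `λ_x` as a permutation. -/
noncomputable def LoopStr.lam {L : Type*} (S : LoopStr L) (x : L) : Equiv.Perm L :=
  Equiv.ofBijective _ (S.mul_left_bij x)

/-- Right translation `ρ_x` as a permutation. -/
noncomputable def LoopStr.rho {L : Type*} (S : LoopStr L) (x : L) : Equiv.Perm L :=
  Equiv.ofBijective _ (S.mul_right_bij x)

/-- The left multiplication group `Mlt_ℓ(L)`. -/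
noncomputable def LoopStr.Mlt {L : Type*} (S : LoopStr L) : Subgroup (Equiv.Perm L) :=
  Subgroup.closure (Set.range S.lam)

/-- Left division: `ldiv a b` is the unique solution `x` of `a·x = b`. -/
noncomputable def LoopStr.ldiv {L : Type*} (S : LoopStr L) (a b : L) : L := (S.lam a).symm b

/-- Right division: `rdiv a b` is the unique solution `x` of `x·b = a`. -/
noncomputable def LoopStr.rdiv {L : Type*} (S : LoopStr L) (a b : L) : L := (S.rho b).symm a

/-- The inner mapping `δ_{x,y} = λ_{xy}⁻¹ ∘ λ_x ∘ λ_y`. -/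
noncomputable def LoopStr.delta {L : Type*} (S : LoopStr L) (x y : L) : Equiv.Perm L :=
  (S.lam (S.mul x y))⁻¹ * S.lam x * S.lam y

/-- A loop homomorphism: preserves the multiplication and the identity. -/
def IsLoopHom {L L' : Type*} (S : LoopStr L) (S' : LoopStr L') (θ : L → L') : Prop :=
  θ S.one = S'.one ∧ ∀ x y, θ (S.mul x y) = S'.mul (θ x) (θ y)

/-- A subloop: a subset containing the identity, closed under multiplication
and both divisions. -/
def IsSubloop {L : Type*} (S : LoopStr L) (N : Set L) : Prop :=
  S.one ∈ N ∧ (∀ a ∈ N, ∀ b ∈ N, S.mul a b ∈ N) ∧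
    (∀ a ∈ N, ∀ b ∈ N, S.ldiv a b ∈ N) ∧ (∀ a ∈ N, ∀ b ∈ N, S.rdiv a b ∈ N)

/-- A normal subloop: `ab·N = a·(bN) = (aN)·b` for all `a, b`. -/
def IsNormalSubloop {L : Type*} (S : LoopStr L) (N : Set L) : Prop :=
  IsSubloop S N ∧ ∀ a b : L,
    ((fun n => S.mul (S.mul a b) n) '' N = (fun n => S.mul a (S.mul b n)) '' N) ∧
    ((fun n => S.mul (S.mul a b) n) '' N = (fun n => S.mul (S.mul a n) b) '' N)

open scoped ComplexOrder

/-- The special unitary group `SU(n)`, as a set of matrices. -/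
def SU (n : ℕ) : Set (Matrix (Fin n) (Fin n) ℂ) :=
  {u | u ∈ Matrix.unitaryGroup (Fin n) ℂ ∧ u.det = 1}

/-- The positive definite hermitian complex `n × n` matrices of determinant 1,
as a type. -/
def LGt (n : ℕ) : Type :=
  {A : Matrix (Fin n) (Fin n) ℂ // A.PosDef ∧ A.det = 1}

/-- The underlying matrix of an element of `LGt n`. -/
def LGt.mat {n : ℕ} (A : LGt n) : Matrix (Fin n) (Fin n) ℂ := A.val

open Matrix in
/-- Uniqueness of the positive definite factor in the polar decomposition. -/
theorem Matrix.PosDef.eq_of_mul_unitary_eq {n : ℕ} {P Q u v : Matrix (Fin n) (Fin n) ℂ}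
    (hP : P.PosDef) (hQ : Q.PosDef) (hu : u ∈ unitaryGroup (Fin n) ℂ)
    (hv : v ∈ unitaryGroup (Fin n) ℂ) (h : P * u = Q * v) : P = Q := by
  have sq_eq : ∀ {R w : Matrix (Fin n) (Fin n) ℂ}, R.PosDef → w ∈ unitaryGroup (Fin n) ℂ →
      (R * w) * star (R * w) = R ^ 2 := fun {R w} hR hw => by
    rw [star_mul, mul_assoc, ← mul_assoc w, mem_unitaryGroup_iff.mp hw, one_mul,
      star_eq_conjTranspose, hR.isHermitian.eq, sq]
  open scoped MatrixOrder Matrix.Norms.L2Operator in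
  exact (CFC.sq_eq_sq_iff P Q hP.posSemidef.nonneg hQ.posSemidef.nonneg).mp
    (by rw [← sq_eq hP hu, h, sq_eq hQ hv])

namespace Matrix.SpecialLinearGroup

variable {ι : Type*} [Fintype ι] [DecidableEq ι]

theorem posDef_mul_mul_conjTranspose (g : SpecialLinearGroup ι ℂ) {P : Matrix ι ι ℂ}
    (hP : P.PosDef) : (g.1 * P * g.1ᴴ).PosDef :=
  hP.mul_mul_conjTranspose_same (vecMul_injective_of_isUnit
    ((isUnit_iff_isUnit_det _).2 (by rw [g.2]; exact isUnit_one)))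

theorem conj_mem_of_posDef_mem {H : Subgroup (SpecialLinearGroup ι ℂ)}
    (hH : ∀ P : SpecialLinearGroup ι ℂ, P.1.PosDef → P ∈ H) (g P : SpecialLinearGroup ι ℂ)
    (hP : P.1.PosDef) : g * P * g⁻¹ ∈ H := by
  let s : SpecialLinearGroup ι ℂ := ⟨g.1ᴴ, by rw [det_conjTranspose, g.2, star_one]⟩
  have h₁ : g * P * s ∈ H := hH _ (posDef_mul_mul_conjTranspose g hP)
  have h₂ : g * s ∈ H := hH _ (by simpa using posDef_mul_mul_conjTranspose g PosDef.one)
  have h : g * P * g⁻¹ = (g * P * s) * (g * s)⁻¹ := by group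
  rw [h]
  exact mul_mem h₁ (inv_mem h₂)

theorem diag2n_mul_transvection {F : Type*} [Field F] {i j : ι} (hij : i ≠ j) {a : F}
    (ha : a ≠ 0) (b : F) :
    diag2n hij a ha * transvection hij b = transvection hij (a ^ 2 * b) * diag2n hij a ha := by
  refine Subtype.ext ?_
  simp only [coe_mul, transvection_coe, diag2n_coe, mul_add, add_mul, mul_one, one_mul]
  congr 1
  ext k l
  simp only [diagonal_mul, mul_diagonal, single_apply]
  split_ifs <;> grind

theorem diag2n_eq_transvection_prod {F : Type*} [Field F] {i j : ι} (hij : i ≠ j) {a : F}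
    (ha : a ≠ 0) :
    diag2n hij a ha = transvection hij a * transvection hij.symm (-a⁻¹) * transvection hij a *
      (transvection hij (-1) * transvection hij.symm 1 * transvection hij (-1)) := by
  have weyl (c : F) (hc : c ≠ 0) : (transvection hij c * transvection hij.symm (-c⁻¹) *
      transvection hij c).1 =
      1 - single i i 1 - single j j 1 + single i j c - single j i c⁻¹ := by
    simp [transvection_coe, mul_add, add_mul, hij.symm, hc]
    ext k l
    simp only [add_apply, sub_apply, single_apply]
    split_ifs <;> grind
  have h := weyl (-1) (by simp)
  simp only [inv_neg, inv_one, neg_neg] at h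
  refine Subtype.ext ?_
  rw [coe_mul, weyl a ha, h, diag2n_coe]
  simp [mul_add, add_mul, mul_sub, sub_mul, hij, hij.symm]
  ext k l
  simp only [add_apply, sub_apply, neg_apply, single_apply, diagonal_apply, one_apply]
  split_ifs <;> grind

theorem eq_top_of_posDef_mem {H : Subgroup (SpecialLinearGroup ι ℂ)}
    (hH : ∀ P : SpecialLinearGroup ι ℂ, P.1.PosDef → P ∈ H) : H = ⊤ := by
  refine eq_top_iff.2 fun M _ => ?_
  cases subsingleton_or_nontrivial ι
  · rw [Subsingleton.elim M 1]
    exact one_mem H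
  have htrans {i j : ι} (hij : i ≠ j) (b : ℂ) : transvection hij b ∈ H := by
    let D : SpecialLinearGroup ι ℂ := diag2n hij 2 two_ne_zero
    have hD : D.1.PosDef := by
      refine PosDef.diagonal fun k => ?_
      split_ifs <;> norm_num
    have h : transvection hij b =
        transvection hij (-b / 3) * D * (transvection hij (-b / 3))⁻¹ * D⁻¹ := by
      rw [eq_mul_inv_iff_mul_eq, transvection_inv, mul_assoc (transvection hij (-b / 3)),
        diag2n_mul_transvection, ← mul_assoc, ← transvection_add]
      congr 2
      ring
    rw [h]
    exact mul_mem (conj_mem_of_posDef_mem hH _ _ hD) (inv_mem (hH _ hD))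
  refine diagonal_transvection_induction' (· ∈ H) M (fun i j hij c hc => ?_)
    (fun i j hij a => htrans hij a) (fun A B => mul_mem)
  rw [diag2n_eq_transvection_prod hij hc]
  exact mul_mem (mul_mem (mul_mem (htrans _ _) (htrans _ _)) (htrans _ _))
    (mul_mem (mul_mem (htrans _ _) (htrans _ _)) (htrans _ _))

end Matrix.SpecialLinearGroup

theorem LGt.ext {n : ℕ} {A B : LGt n} (h : A.mat = B.mat) : A = B := Subtype.ext h

theorem LGt.posDef {n : ℕ} (A : LGt n) : A.mat.PosDef := A.2.1

theorem SU.one_mem {n : ℕ} : (1 : Matrix (Fin n) (Fin n) ℂ) ∈ SU n :=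
  ⟨Submonoid.one_mem _, Matrix.det_one⟩

theorem SU.mul_mem {n : ℕ} {u v : Matrix (Fin n) (Fin n) ℂ} (hu : u ∈ SU n) (hv : v ∈ SU n) :
    u * v ∈ SU n :=
  ⟨Submonoid.mul_mem _ hu.1 hv.1, by rw [Matrix.det_mul, hu.2, hv.2, one_mul]⟩

theorem SU.mul_star_self {n : ℕ} {u : Matrix (Fin n) (Fin n) ℂ} (hu : u ∈ SU n) :
    u * star u = 1 := Matrix.mem_unitaryGroup_iff.mp hu.1

theorem SU.star_mul_self {n : ℕ} {u : Matrix (Fin n) (Fin n) ℂ} (hu : u ∈ SU n) :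
    star u * u = 1 := Matrix.mem_unitaryGroup_iff'.mp hu.1

theorem SU.star_mem {n : ℕ} {u : Matrix (Fin n) (Fin n) ℂ} (hu : u ∈ SU n) : star u ∈ SU n :=
  ⟨Unitary.star_mem hu.1, by
    rw [Matrix.star_eq_conjTranspose, Matrix.det_conjTranspose, hu.2, star_one]⟩

theorem SU.inv_eq_star {n : ℕ} {u : Matrix (Fin n) (Fin n) ℂ} (hu : u ∈ SU n) : u⁻¹ = star u :=
  Matrix.inv_eq_right_inv (SU.mul_star_self hu)

/-- `g` acts on positive definite matrices as `α`: the positive definite polar factor of `g * A`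
is `α A`. -/
def PolarActs {n : ℕ} (g : Matrix.SpecialLinearGroup (Fin n) ℂ) (α : Equiv.Perm (LGt n)) : Prop :=
  ∀ A : LGt n, ∃ u ∈ SU n, g.1 * A.mat = (α A).mat * u

namespace PolarActs

variable {n : ℕ} {g h : Matrix.SpecialLinearGroup (Fin n) ℂ} {α β : Equiv.Perm (LGt n)}

theorem one : PolarActs (1 : Matrix.SpecialLinearGroup (Fin n) ℂ) 1 :=
  fun A => ⟨1, SU.one_mem, by simp⟩

theorem mul (hg : PolarActs g α) (hh : PolarActs h β) : PolarActs (g * h) (α * β) := fun A => by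
  obtain ⟨u, hu, hu'⟩ := hh A
  obtain ⟨v, hv, hv'⟩ := hg (β A)
  refine ⟨v * u, SU.mul_mem hv hu, ?_⟩
  rw [Matrix.SpecialLinearGroup.coe_mul, mul_assoc, hu', ← mul_assoc, hv', mul_assoc]
  rfl

theorem inv (hg : PolarActs g α) : PolarActs g⁻¹ α⁻¹ := fun A => by
  obtain ⟨u, hu, hu'⟩ := hg (α⁻¹ A)
  rw [show α (α⁻¹ A) = A from α.apply_symm_apply A] at hu'
  refine ⟨star u, SU.star_mem hu, ?_⟩
  have hA : A.mat = g.1 * (α⁻¹ A).mat * star u := by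
    rw [hu', mul_assoc, SU.mul_star_self hu, mul_one]
  have hg' : (g⁻¹).1 * g.1 = 1 := congrArg Subtype.val (inv_mul_cancel g)
  rw [hA, ← mul_assoc, ← mul_assoc, hg', one_mul]

/-- The action of a special unitary matrix is conjugation. -/
theorem apply_eq_of_mem_SU (hg : PolarActs g α) (hgu : g.1 ∈ SU n) {A B : LGt n}
    (hB : B.mat = g.1 * A.mat * g.1⁻¹) : α A = B := by
  obtain ⟨u, hu, hu'⟩ := hg A
  refine LGt.ext ((α A).posDef.eq_of_mul_unitary_eq B.posDef hu.1 hgu.1 ?_)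
  rw [← hu', hB, SU.inv_eq_star hgu, mul_assoc, SU.star_mul_self hgu, mul_one]

/-- An element whose action fixes the identity matrix is special unitary. -/
theorem mem_SU (hg : PolarActs g α) {E : LGt n} (hE : E.mat = 1) (hα : α E = E) :
    g.1 ∈ SU n := by
  obtain ⟨u, hu, hu'⟩ := hg E
  rw [hα, hE, mul_one, one_mul] at hu'
  rwa [hu']

end PolarActs

theorem exists_mat_eq_conj {n : ℕ} {u : Matrix (Fin n) (Fin n) ℂ} (hu : u ∈ SU n) (A : LGt n) :
    ∃ B : LGt n, B.mat = u * A.mat * u⁻¹ := by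
  let g : Matrix.SpecialLinearGroup (Fin n) ℂ := ⟨u, hu.2⟩
  refine ⟨⟨u * A.mat * u⁻¹, ?_, ?_⟩, rfl⟩
  · rw [SU.inv_eq_star hu]
    exact g.posDef_mul_mul_conjTranspose A.posDef
  · rw [Matrix.det_conj ((Matrix.isUnit_iff_isUnit_det _).2 (by rw [hu.2]; exact isUnit_one))]
    exact A.2.2

/-- An element of `LGt n` as an element of `SL(n, ℂ)`. -/
def LGt.toSL {n : ℕ} (A : LGt n) : Matrix.SpecialLinearGroup (Fin n) ℂ := ⟨A.1, A.2.2⟩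

namespace LoopStr

variable {n : ℕ} {S : LoopStr (LGt n)}

theorem polarActs_lam
    (hmul : ∀ A B : LGt n, ∃ u ∈ SU n, A.mat * B.mat = (S.mul A B).mat * u) (A : LGt n) :
    PolarActs A.toSL (S.lam A) := hmul A

theorem exists_polarActs_of_mem_Mlt
    (hmul : ∀ A B : LGt n, ∃ u ∈ SU n, A.mat * B.mat = (S.mul A B).mat * u)
    {α : Equiv.Perm (LGt n)} (hα : α ∈ S.Mlt) : ∃ g, PolarActs g α := by
  induction hα using Subgroup.closure_induction with
  | mem x hx =>
    obtain ⟨A, rfl⟩ := hx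
    exact ⟨_, polarActs_lam hmul A⟩
  | one => exact ⟨1, .one⟩
  | mul x y _ _ hx hy =>
    obtain ⟨g, hg⟩ := hx
    obtain ⟨h, hh⟩ := hy
    exact ⟨_, hg.mul hh⟩
  | inv x _ hx =>
    obtain ⟨g, hg⟩ := hx
    exact ⟨_, hg.inv⟩

theorem exists_mem_Mlt_polarActs
    (hmul : ∀ A B : LGt n, ∃ u ∈ SU n, A.mat * B.mat = (S.mul A B).mat * u)
    (g : Matrix.SpecialLinearGroup (Fin n) ℂ) : ∃ α ∈ S.Mlt, PolarActs g α := by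
  let K : Subgroup (Matrix.SpecialLinearGroup (Fin n) ℂ) :=
    { carrier := {g | ∃ α ∈ S.Mlt, PolarActs g α}
      one_mem' := ⟨1, one_mem _, .one⟩
      mul_mem' := fun ⟨α, hα, hg⟩ ⟨β, hβ, hh⟩ => ⟨α * β, mul_mem hα hβ, hg.mul hh⟩
      inv_mem' := fun ⟨α, hα, hg⟩ => ⟨α⁻¹, inv_mem hα, hg.inv⟩ }
  have hK : K = ⊤ := Matrix.SpecialLinearGroup.eq_top_of_posDef_mem fun P hP =>
    ⟨_, Subgroup.subset_closure ⟨⟨P.1, hP, P.2⟩, rfl⟩, polarActs_lam hmul ⟨P.1, hP, P.2⟩⟩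
  exact (hK ▸ Subgroup.mem_top g : g ∈ K)

theorem polarActs_delta
    (hmul : ∀ A B : LGt n, ∃ u ∈ SU n, A.mat * B.mat = (S.mul A B).mat * u) (A B : LGt n) :
    PolarActs ((S.mul A B).toSL⁻¹ * A.toSL * B.toSL) (S.delta A B) :=
  ((polarActs_lam hmul _).inv.mul (polarActs_lam hmul A)).mul (polarActs_lam hmul B)

end LoopStr

/-- For the K-loop of positive definite hermitian
determinant-1 matrices with operation from polar decomposition in `SL(n, ℂ)`,
the left inner mapping group `Δ(L_G)` equals `{ ω̂ : ω ∈ SU(n) }` where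
`ω̂(A) = ωAω⁻¹`; in particular each `δ_{A,B}` is conjugation by `d_{A,B}`. -/
theorem stmt13 (n : ℕ) (S : LoopStr (LGt n)) (hone : S.one.mat = 1)
    (hmul : ∀ A B : LGt n, ∃ u ∈ SU n, A.mat * B.mat = (S.mul A B).mat * u) :
    (∀ α : Equiv.Perm (LGt n), (α ∈ S.Mlt ∧ α S.one = S.one) ↔
      ∃ ω ∈ SU n, ∀ A B : LGt n, B.mat = ω * A.mat * ω⁻¹ → α A = B) ∧
    (∀ A B : LGt n, ∀ u ∈ SU n, A.mat * B.mat = (S.mul A B).mat * u →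
      ∀ C D : LGt n, D.mat = u * C.mat * u⁻¹ → (S.delta A B) C = D) := by
  refine ⟨fun α => ⟨fun ⟨hα, hα1⟩ => ?_, fun ⟨ω, hω, hconj⟩ => ?_⟩, fun A B u hu hAB C D hD => ?_⟩
  · obtain ⟨g, hg⟩ := LoopStr.exists_polarActs_of_mem_Mlt hmul hα
    have hgu := hg.mem_SU hone hα1
    exact ⟨g.1, hgu, fun A B hB => hg.apply_eq_of_mem_SU hgu hB⟩
  · obtain ⟨β, hβ, hωβ⟩ := LoopStr.exists_mem_Mlt_polarActs hmul ⟨ω, hω.2⟩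
    have hαβ : α = β := Equiv.ext fun A => by
      obtain ⟨B, hB⟩ := exists_mat_eq_conj hω A
      rw [hconj A B hB, hωβ.apply_eq_of_mem_SU hω hB]
    refine ⟨hαβ ▸ hβ, hconj _ _ ?_⟩
    rw [hone, mul_one, SU.inv_eq_star hω, SU.mul_star_self hω]
  · have hg : (S.mul A B).toSL⁻¹ * A.toSL * B.toSL = ⟨u, hu.2⟩ := by
      rw [mul_assoc]
      exact inv_mul_eq_iff_eq_mul.2 (Subtype.ext hAB)
    have h := LoopStr.polarActs_delta hmul A B
    rw [hg] at h
    exact h.apply_eq_of_mem_SU hu hD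
end

section
/- Let G = SL(n, ℂ) (n ≥ 2), Ω = SU(n), and (L_G, ∘) the K-loop of positive definite hermitian determinant-1 matrices with operation from polar decomposition. The map Φ : G → L_G ⋊_Q Δ(L_G) sending g = Aω (A ∈ L_G, ω ∈ Ω the polar factors) to (A, ω̂), where ω̂(B) = ωBω⁻¹, is a group epimorphism from G onto the quasidirect product (which is isomorphic to the left multiplication group Mlt_ℓ(L_G)). -/
open scoped ComplexOrder

open Matrix Matrix.SpecialLinearGroup

namespace LGt

variable {n : ℕ}

lemma posDef_s14 (A : LGt n) : A.mat.PosDef := A.2.1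

lemma det_mat (A : LGt n) : A.mat.det = 1 := A.2.2

lemma isHermitian (A : LGt n) : A.matᴴ = A.mat := A.posDef_s14.isHermitian

open scoped MatrixOrder in
lemma eq_of_mul_self_eq {A B : LGt n} (h : A.mat * A.mat = B.mat * B.mat) : A = B := by
  have hA := CFC.sqrt_mul_self A.mat A.posDef_s14.posSemidef.nonneg
  have hB := CFC.sqrt_mul_self B.mat B.posDef_s14.posSemidef.nonneg
  exact Subtype.ext (hA.symm.trans (h ▸ hB))

open scoped MatrixOrder in
lemma exists_mul_self_eq {M : Matrix (Fin n) (Fin n) ℂ} (hM : M.PosDef) (hdet : M.det = 1) :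
    ∃ A : LGt n, A.mat * A.mat = M := by
  have hsq := CFC.sqrt_mul_sqrt_self M hM.posSemidef.nonneg
  have hd : (CFC.sqrt M).det = 1 := by
    rw [hM.posSemidef.det_sqrt, hdet, RCLike.sqrt_one]
  have hu : IsUnit (CFC.sqrt M) := by
    rw [isUnit_iff_isUnit_det, hd]
    exact isUnit_one
  exact ⟨⟨CFC.sqrt M, (CFC.sqrt_nonneg M).posSemidef.posDef_iff_isUnit.2 hu, hd⟩, hsq⟩

lemma exists_mul_self_eq_conj (g : SpecialLinearGroup (Fin n) ℂ) (B : LGt n) :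
    ∃ A : LGt n, A.mat * A.mat = g.1 * (B.mat * B.mat) * g.1ᴴ := by
  have hu : IsUnit (g.1 * B.mat) := by
    rw [isUnit_iff_isUnit_det, det_mul, g.2, B.det_mat, one_mul]
    exact isUnit_one
  apply exists_mul_self_eq
  · have h := PosDef.mul_conjTranspose_self (g.1 * B.mat) (vecMul_injective_of_isUnit hu)
    rwa [conjTranspose_mul, B.isHermitian, Matrix.mul_assoc, ← Matrix.mul_assoc B.mat,
      ← Matrix.mul_assoc] at h
  · simp only [det_mul, det_conjTranspose, g.2, B.det_mat, mul_one, star_one]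

/-- The action of `g ∈ SL(n, ℂ)` on positive definite matrices, `B ↦ √(g B² gᴴ)`. -/
noncomputable instance : MulAction (SpecialLinearGroup (Fin n) ℂ) (LGt n) where
  smul g B := (exists_mul_self_eq_conj g B).choose
  one_smul B := eq_of_mul_self_eq <| by
    refine (exists_mul_self_eq_conj 1 B).choose_spec.trans ?_
    change (1 : Matrix (Fin n) (Fin n) ℂ) * _ * 1ᴴ = _
    simp
  mul_smul g h B := eq_of_mul_self_eq <| by
    refine (exists_mul_self_eq_conj (g * h) B).choose_spec.trans ?_
    refine Eq.trans ?_ (exists_mul_self_eq_conj g _).choose_spec.symm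
    refine Eq.trans ?_ (congrArg (fun M => g.1 * M * g.1ᴴ)
      (exists_mul_self_eq_conj h B).choose_spec.symm)
    change (g.1 * h.1) * _ * (g.1 * h.1)ᴴ = _
    simp only [conjTranspose_mul, Matrix.mul_assoc]

lemma smul_mul_self (g : SpecialLinearGroup (Fin n) ℂ) (B : LGt n) :
    (g • B).mat * (g • B).mat = g.1 * (B.mat * B.mat) * g.1ᴴ :=
  (exists_mul_self_eq_conj g B).choose_spec

lemma smul_eq_iff {g : SpecialLinearGroup (Fin n) ℂ} {B C : LGt n} :
    g • B = C ↔ C.mat * C.mat = g.1 * (B.mat * B.mat) * g.1ᴴ :=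
  ⟨fun h => h ▸ smul_mul_self g B, fun h => eq_of_mul_self_eq ((smul_mul_self g B).trans h.symm)⟩

lemma mul_self_of_polar {A B C u : Matrix (Fin n) (Fin n) ℂ} (hA : Aᴴ = A) (hB : Bᴴ = B)
    (hC : Cᴴ = C) (hu : u ∈ unitaryGroup (Fin n) ℂ) (h : A * B = C * u) :
    C * C = A * (B * B) * A := by
  calc C * C = C * (u * uᴴ) * Cᴴ := by
        rw [← star_eq_conjTranspose u, mem_unitaryGroup_iff.1 hu, Matrix.mul_one, hC]
    _ = C * u * (C * u)ᴴ := by simp only [conjTranspose_mul, Matrix.mul_assoc]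
    _ = A * (B * B) * A := by
        rw [← h, conjTranspose_mul, hA, hB]
        simp only [Matrix.mul_assoc]

end LGt

namespace Matrix.SpecialLinearGroup

variable {ι F : Type*} [Fintype ι] [DecidableEq ι] [Field F] {i j : ι}

lemma diag2n_coe_eq_add_single (hij : i ≠ j) {c : F} (hc : c ≠ 0) :
    (diag2n hij c hc).1 = 1 + single i i (c - 1) + single j j (c⁻¹ - 1) := by
  rw [diag2n_coe]
  ext k l
  simp only [Matrix.add_apply, single_apply, diagonal_apply, one_apply]
  grind

lemma transvection_eq_commutator (hij : i ≠ j) {c : F} (hc : c ≠ 0) (b : F) :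
    transvection hij ((1 - c ^ 2) * b) =
      transvection hij b * diag2n hij c hc * (transvection hij b)⁻¹ * (diag2n hij c hc)⁻¹ := by
  rw [eq_mul_inv_iff_mul_eq, eq_mul_inv_iff_mul_eq]
  apply Subtype.ext
  simp only [coe_mul, transvection_coe, diag2n_coe_eq_add_single, add_mul, mul_add,
    Matrix.one_mul, Matrix.mul_one, single_mul_single_same,
    single_mul_single_of_ne _ _ _ _ hij.symm, add_zero]
  ext k l
  simp only [Matrix.add_apply, single_apply]
  grind

lemma diag2n_eq_prod_transvection (hij : i ≠ j) {c : F} (hc : c ≠ 0) :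
    diag2n hij c hc = transvection hij c * transvection hij.symm (-c⁻¹) * transvection hij c *
      (transvection hij (-1) * transvection hij.symm 1 * transvection hij (-1)) := by
  apply Subtype.ext
  simp only [diag2n_coe_eq_add_single, coe_mul, transvection_coe, add_mul, mul_add,
    Matrix.one_mul, Matrix.mul_one, single_mul_single_same, single_mul_single_of_ne _ _ _ _ hij,
    single_mul_single_of_ne _ _ _ _ hij.symm, add_zero]
  ext k l
  simp only [Matrix.add_apply, single_apply]
  grind

variable {n : ℕ} {H : Subgroup (SpecialLinearGroup (Fin n) ℂ)}

lemma conj_mem_of_posDef_mem_s14 (hH : ∀ g : SpecialLinearGroup (Fin n) ℂ, g.1.PosDef → g ∈ H)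
    {d : SpecialLinearGroup (Fin n) ℂ} (hd : d.1.PosDef) (t : SpecialLinearGroup (Fin n) ℂ) :
    t * d * t⁻¹ ∈ H := by
  have hunit (g : SpecialLinearGroup (Fin n) ℂ) : IsUnit g.1 := by
    rw [isUnit_iff_isUnit_det, g.2]
    exact isUnit_one
  let x : SpecialLinearGroup (Fin n) ℂ := ⟨t.1 * t.1ᴴ, by
    simp only [det_mul, det_conjTranspose, t.2, mul_one, star_one]⟩
  let y : SpecialLinearGroup (Fin n) ℂ := ⟨t⁻¹.1ᴴ * d.1 * t⁻¹.1, by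
    simp only [det_mul, det_conjTranspose, t⁻¹.2, d.2, mul_one, star_one]⟩
  have hx : x ∈ H := hH x (PosDef.mul_conjTranspose_self _ (vecMul_injective_of_isUnit (hunit t)))
  have hy : y ∈ H :=
    hH y (hd.conjTranspose_mul_mul_same (mulVec_injective_of_isUnit (hunit t⁻¹)))
  have hxy : t * d * t⁻¹ = x * y := by
    have h1 : t⁻¹.1 * t.1 = 1 := congrArg Subtype.val (inv_mul_cancel t)
    have h2 : t.1ᴴ * t⁻¹.1ᴴ = 1 := by rw [← conjTranspose_mul, h1, conjTranspose_one]
    apply Subtype.ext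
    change t.1 * d.1 * t⁻¹.1 = t.1 * t.1ᴴ * (t⁻¹.1ᴴ * d.1 * t⁻¹.1)
    calc t.1 * d.1 * t⁻¹.1 = t.1 * (t.1ᴴ * t⁻¹.1ᴴ) * d.1 * t⁻¹.1 := by rw [h2, Matrix.mul_one]
      _ = _ := by simp only [Matrix.mul_assoc]
  exact hxy ▸ H.mul_mem hx hy

/-- `SL(n, ℂ)` is generated by its positive definite elements. -/
lemma eq_top_of_posDef_mem_s14 (hn : 2 ≤ n)
    (hH : ∀ g : SpecialLinearGroup (Fin n) ℂ, g.1.PosDef → g ∈ H) : H = ⊤ := by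
  have : Nontrivial (Fin n) := Fin.nontrivial_iff_two_le.2 hn
  have htrans (i j : Fin n) (hij : i ≠ j) (a : ℂ) : transvection hij a ∈ H := by
    have hd : (diag2n hij (2 : ℂ) two_ne_zero).1.PosDef := by
      rw [diag2n_coe]
      refine PosDef.diagonal fun k => ?_
      split_ifs <;> simp
    have ha : a = (1 - (2 : ℂ) ^ 2) * (-a / 3) := by ring
    rw [ha, transvection_eq_commutator hij two_ne_zero]
    exact H.mul_mem (conj_mem_of_posDef_mem_s14 hH hd _) (H.inv_mem (hH _ hd))
  refine eq_top_iff.2 fun g _ => diagonal_transvection_induction' (· ∈ H) g ?_ htrans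
    fun _ _ => H.mul_mem
  intro i j hij c hc
  rw [diag2n_eq_prod_transvection hij hc]
  have hmul {x y} := H.mul_mem (x := x) (y := y)
  exact hmul (hmul (hmul (htrans ..) (htrans ..)) (htrans ..))
    (hmul (hmul (htrans ..) (htrans ..)) (htrans ..))

end Matrix.SpecialLinearGroup

lemma LoopStr.lam_eq_toPerm {n : ℕ} (S : LoopStr (LGt n))
    (hmul : ∀ A B : LGt n, ∃ u ∈ SU n, A.mat * B.mat = (S.mul A B).mat * u) (A : LGt n) :
    S.lam A = MulAction.toPermHom (SpecialLinearGroup (Fin n) ℂ) (LGt n) ⟨A.mat, A.det_mat⟩ := by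
  ext1 B
  obtain ⟨u, hu, h⟩ := hmul A B
  refine (LGt.smul_eq_iff.2 ?_).symm
  change (S.mul A B).mat * (S.mul A B).mat = A.mat * (B.mat * B.mat) * A.matᴴ
  rw [A.isHermitian]
  exact LGt.mul_self_of_polar A.isHermitian B.isHermitian (S.mul A B).isHermitian hu.1 h

/-- The map `Φ : SL(n, ℂ) → L_G ⋊_Q Δ(L_G) ≅ Mlt_ℓ(L_G)`
sending `g = Aω` (polar factors `A ∈ L_G`, `ω ∈ SU(n)`) to `(A, ω̂)`, i.e.
to the permutation `B ↦ A ∘ ω̂(B)` with `ω̂(B) = ωBω⁻¹`, is a group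
epimorphism onto the left multiplication group. -/
theorem stmt14 (n : ℕ) (hn : 2 ≤ n) (S : LoopStr (LGt n)) (hone : S.one.mat = 1)
    (hmul : ∀ A B : LGt n, ∃ u ∈ SU n, A.mat * B.mat = (S.mul A B).mat * u) :
    ∃ Φ : Matrix.SpecialLinearGroup (Fin n) ℂ →* ↥S.Mlt,
      Function.Surjective Φ ∧
      ∀ (g : Matrix.SpecialLinearGroup (Fin n) ℂ)
        (A ω : Matrix (Fin n) (Fin n) ℂ)
        (hA : A.PosDef ∧ A.det = 1), ω ∈ SU n → (g : Matrix (Fin n) (Fin n) ℂ) = A * ω →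
        ∀ B C : LGt n, C.mat = ω * B.mat * ω⁻¹ →
          ((Φ g : Equiv.Perm (LGt n)) B) = S.mul ⟨A, hA⟩ C := by
  set ψ := MulAction.toPermHom (SpecialLinearGroup (Fin n) ℂ) (LGt n)
  have hlam := S.lam_eq_toPerm hmul
  have hmem (g : SpecialLinearGroup (Fin n) ℂ) : ψ g ∈ S.Mlt := by
    have htop : S.Mlt.comap ψ = ⊤ := eq_top_of_posDef_mem_s14 hn fun g hg => by
      have h := hlam ⟨g.1, hg, g.2⟩
      exact Subgroup.mem_comap.2 (h ▸ Subgroup.subset_closure ⟨_, rfl⟩)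
    exact Subgroup.mem_comap.1 (htop ▸ Subgroup.mem_top g)
  refine ⟨ψ.codRestrict S.Mlt hmem, ?_, ?_⟩
  · rintro ⟨σ, hσ⟩
    have hle : S.Mlt ≤ ψ.range := by
      refine (Subgroup.closure_le _).2 ?_
      rintro _ ⟨A, rfl⟩
      exact ⟨_, (hlam A).symm⟩
    obtain ⟨g, hg⟩ := hle hσ
    exact ⟨g, Subtype.ext hg⟩
  · intro g A ω hA hω hg B C hC
    have hlamA := congrArg (fun σ : Equiv.Perm (LGt n) => σ C) (hlam ⟨A, hA⟩)
    change S.mul ⟨A, hA⟩ C =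
      (show SpecialLinearGroup (Fin n) ℂ from ⟨A, hA.2⟩) • C at hlamA
    change g • B = _
    rw [hlamA]
    refine LGt.smul_eq_iff.2 ((LGt.smul_mul_self _ _).trans ?_)
    have hdet : IsUnit ω.det := by rw [hω.2]; exact isUnit_one
    have hinv : ω⁻¹ = ωᴴ := inv_eq_right_inv (mem_unitaryGroup_iff.1 hω.1)
    change A * (C.mat * C.mat) * Aᴴ = g.1 * (B.mat * B.mat) * g.1ᴴ
    have hCC : C.mat * C.mat = ω * (B.mat * B.mat) * ωᴴ := by
      calc C.mat * C.mat = ω * B.mat * (ω⁻¹ * ω) * B.mat * ω⁻¹ := by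
            rw [hC]
            simp only [Matrix.mul_assoc]
        _ = ω * (B.mat * B.mat) * ωᴴ := by
            rw [nonsing_inv_mul _ hdet, Matrix.mul_one, hinv, Matrix.mul_assoc ω]
    rw [hCC, hg, conjTranspose_mul]
    simp only [Matrix.mul_assoc]
end
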